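/- arXiv:1809.08154 — 2 statements merged into one kernel-verified Lean document; each statement's English description precedes it below -/
import Mathlib

section
/- Suppose n ≥ 2 and every variable occurs in at least one clause of φ. Then every automorphism of the graph G_φ that fixes every variable vertex X^0 and X^1 is the identity. -/
open SimpleGraph

/-- A homogeneous 3-XOR formula over the `n` variables `X_0 < X_1 < … < X_{n-1}`:
a finite set of pairwise distinct clauses, each clause being a 3-element subset
of the variables (given as a triple listed in increasing order) and encoding the
equation `x + y + z = 0` over the field `𝔽₂`. -/
structure HomXor (n : ℕ) : Type where
  clauses : Finset (Fin n × Fin n × Fin n)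
  ordered : ∀ c ∈ clauses, c.1 < c.2.1 ∧ c.2.1 < c.2.2

namespace HomXor

variable {n : ℕ}

/-- The assignment `T` satisfies `φ`: in every clause the three variables sum
to `0` over `𝔽₂`. -/
def Satisfies (φ : HomXor n) (T : Fin n → ZMod 2) : Prop :=
  ∀ c ∈ φ.clauses, T c.1 + T c.2.1 + T c.2.2 = 0

/-- The variable `x` occurs in at least one clause of `φ`. -/
def OccursIn (φ : HomXor n) (x : Fin n) : Prop :=
  ∃ c ∈ φ.clauses, x = c.1 ∨ x = c.2.1 ∨ x = c.2.2

/-- The vertices of the graph `G_φ`: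
* `cl c a b` is the clause vertex `C_{a b (a+b)}` — note that
  `{C_{000}, C_{011}, C_{110}, C_{101}}` is exactly the set of `C_{a b c}`
  with `a + b + c = 0` in `𝔽₂`, so the four clause vertices of `C` are
  `cl c a b` for `(a, b) ∈ 𝔽₂ × 𝔽₂`;
* `var x v` is the variable vertex `X_x^v`;
* `lt i`, `rt i`, `st i` are the vertices `i_l`, `i_r`, `i_s` — here `i`
  ranges over `Fin (n-1)`, with `i : Fin (n-1)` representing the paper's
  (1-based) index `i+1`, so in terms of 0-based variable indices the vertex
  `lt i` is attached to the variable `i` and `rt i` to the variable `i+1`. -/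
inductive Vtx (φ : HomXor n) : Type
  | cl (c : {c // c ∈ φ.clauses}) (a b : ZMod 2)
  | var (x : Fin n) (v : ZMod 2)
  | lt (i : Fin (n - 1))
  | rt (i : Fin (n - 1))
  | st (i : Fin (n - 1))
  deriving DecidableEq

/-- The variable attached to `i_l` (the paper's `X_i`), as an element of `Fin n`. -/
def low (i : Fin (n - 1)) : Fin n := ⟨i.1, lt_of_lt_of_le i.2 (Nat.sub_le n 1)⟩

/-- The variable attached to `i_r` (the paper's `X_{i+1}`), as an element of `Fin n`. -/
def high (i : Fin (n - 1)) : Fin n := ⟨i.1 + 1, by have := i.2; omega⟩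

/-- The edges of the graph `G_φ`.  For a clause `C` with variables
`x < y < z`, the clause vertex `C_{a b (a+b)}` is adjacent to `x^{1+a}`,
`y^{1+b}` and `z^{1+a+b}` (this is exactly: `C_{000}` adjacent to
`x^1, y^1, z^1`; `C_{011}` to `x^1, y^0, z^0`; `C_{110}` to `x^0, y^0, z^1`;
`C_{101}` to `x^0, y^1, z^0`).  For each variable `X` there is an edge between
`X^0` and `X^1`, and for each `i` there are the asymmetry-gadget edges
`{i_l, i_r}`, `{i_r, i_s}`, `{i_l, X_i^0}`, `{i_l, X_i^1}`, `{i_r, X_{i+1}^0}`,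
`{i_r, X_{i+1}^1}`. -/
inductive Edge (φ : HomXor n) : Vtx φ → Vtx φ → Prop
  | cx (c : {c // c ∈ φ.clauses}) (a b : ZMod 2) :
      Edge φ (Vtx.cl c a b) (Vtx.var c.1.1 (1 + a))
  | cy (c : {c // c ∈ φ.clauses}) (a b : ZMod 2) :
      Edge φ (Vtx.cl c a b) (Vtx.var c.1.2.1 (1 + b))
  | cz (c : {c // c ∈ φ.clauses}) (a b : ZMod 2) :
      Edge φ (Vtx.cl c a b) (Vtx.var c.1.2.2 (1 + a + b))
  | xx (x : Fin n) : Edge φ (Vtx.var x 0) (Vtx.var x 1)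
  | lr (i : Fin (n - 1)) : Edge φ (Vtx.lt i) (Vtx.rt i)
  | rs (i : Fin (n - 1)) : Edge φ (Vtx.rt i) (Vtx.st i)
  | lv (i : Fin (n - 1)) (v : ZMod 2) : Edge φ (Vtx.lt i) (Vtx.var (low i) v)
  | rv (i : Fin (n - 1)) (v : ZMod 2) : Edge φ (Vtx.rt i) (Vtx.var (high i) v)

/-- The graph `G_φ`. -/
def G (φ : HomXor n) : SimpleGraph (Vtx φ) := SimpleGraph.fromRel (Edge φ)

end HomXor

namespace HomXor

variable {n : ℕ} {φ : HomXor n}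

lemma adj_cl_var_iff {c : {c // c ∈ φ.clauses}} {a b w : ZMod 2} {x : Fin n} :
    (G φ).Adj (Vtx.cl c a b) (Vtx.var x w) ↔
      (x = c.1.1 ∧ w = 1 + a) ∨ (x = c.1.2.1 ∧ w = 1 + b) ∨
        (x = c.1.2.2 ∧ w = 1 + a + b) := by
  rw [G, SimpleGraph.fromRel_adj]
  constructor
  · rintro ⟨-, h | h⟩ <;> cases h <;> simp
  · rintro (⟨rfl, rfl⟩ | ⟨rfl, rfl⟩ | ⟨rfl, rfl⟩)
    exacts [⟨by simp, .inl (.cx ..)⟩, ⟨by simp, .inl (.cy ..)⟩, ⟨by simp, .inl (.cz ..)⟩]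

lemma adj_lt_var_iff {i : Fin (n - 1)} {w : ZMod 2} {x : Fin n} :
    (G φ).Adj (Vtx.lt i) (Vtx.var x w) ↔ x = low i := by
  rw [G, SimpleGraph.fromRel_adj]
  constructor
  · rintro ⟨-, h | h⟩ <;> cases h
    rfl
  · rintro rfl
    exact ⟨by simp, .inl (.lv ..)⟩

lemma adj_rt_var_iff {i : Fin (n - 1)} {w : ZMod 2} {x : Fin n} :
    (G φ).Adj (Vtx.rt i) (Vtx.var x w) ↔ x = high i := by
  rw [G, SimpleGraph.fromRel_adj]
  constructor
  · rintro ⟨-, h | h⟩ <;> cases h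
    rfl
  · rintro rfl
    exact ⟨by simp, .inl (.rv ..)⟩

lemma adj_st_iff {i : Fin (n - 1)} {v : Vtx φ} :
    (G φ).Adj (Vtx.st i) v ↔ v = Vtx.rt i := by
  rw [G, SimpleGraph.fromRel_adj]
  constructor
  · rintro ⟨-, h | h⟩ <;> cases h
    rfl
  · rintro rfl
    exact ⟨by simp, .inr (.rs ..)⟩

lemma low_injective : Function.Injective (low : Fin (n - 1) → Fin n) := fun i j h => by
  simpa [low, Fin.ext_iff] using h

lemma high_injective : Function.Injective (high : Fin (n - 1) → Fin n) := fun i j h => by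
  simpa [high, Fin.ext_iff] using h

/-- A clause vertex is determined, among non-variable vertices, by its variable neighbours. -/
lemma eq_cl_of_adj_var {c : {c // c ∈ φ.clauses}} {a b : ZMod 2} {v : Vtx φ}
    (hv : ∀ x w, v ≠ Vtx.var x w)
    (h : ∀ x w, (G φ).Adj (Vtx.cl c a b) (Vtx.var x w) → (G φ).Adj v (Vtx.var x w)) :
    v = Vtx.cl c a b := by
  have h₁ := h c.1.1 (1 + a) (adj_cl_var_iff.2 (by simp))
  have h₂ := h c.1.2.1 (1 + b) (adj_cl_var_iff.2 (by simp))
  have h₃ := h c.1.2.2 (1 + a + b) (adj_cl_var_iff.2 (by simp))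
  obtain ⟨hc₁, hc₂⟩ := φ.ordered c.1 c.2
  cases v with
  | cl d a' b' =>
    obtain ⟨hd₁, hd₂⟩ := φ.ordered d.1 d.2
    rw [adj_cl_var_iff] at h₁ h₂ h₃
    have e₁ : c.1.1 = d.1.1 := by omega
    have e₂ : c.1.2.1 = d.1.2.1 := by omega
    have e₃ : c.1.2.2 = d.1.2.2 := by omega
    obtain rfl : c = d := Subtype.ext (Prod.ext e₁ (Prod.ext e₂ e₃))
    have ha : a = a' := by simpa [hc₁.ne, (hc₁.trans hc₂).ne] using h₁
    have hb : b = b' := by simpa [hc₁.ne', hc₂.ne] using h₂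
    rw [ha, hb]
  | var x w => exact absurd rfl (hv x w)
  | lt i =>
    rw [adj_lt_var_iff] at h₁ h₂
    exact absurd (h₁.trans h₂.symm) hc₁.ne
  | rt i =>
    rw [adj_rt_var_iff] at h₁ h₂
    exact absurd (h₁.trans h₂.symm) hc₁.ne
  | st i => simp [adj_st_iff] at h₁

/-- The vertices `i_s` are the only non-variable vertices without variable neighbours. -/
lemma exists_eq_st_of_not_adj_var {v : Vtx φ} (hv : ∀ x w, v ≠ Vtx.var x w)
    (h : ∀ x w, ¬ (G φ).Adj v (Vtx.var x w)) : ∃ i, v = Vtx.st i := by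
  cases v with
  | cl c a b => exact absurd (adj_cl_var_iff.2 (.inl ⟨rfl, rfl⟩)) (h c.1.1 (1 + a))
  | var x w => exact absurd rfl (hv x w)
  | lt i => exact absurd (adj_lt_var_iff.2 rfl) (h (low i) 0)
  | rt i => exact absurd (adj_rt_var_iff.2 rfl) (h (high i) 0)
  | st i => exact ⟨i, rfl⟩

end HomXor

open HomXor in
/-- If `n ≥ 2` and every variable occurs in at least one clause of `φ`, then
every automorphism of `G_φ` fixing every variable vertex is the identity. -/
theorem automorphism_fixing_variables_is_id {n : ℕ} (φ : HomXor n) (hn : 2 ≤ n)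
    (hocc : ∀ x : Fin n, φ.OccursIn x) (α : G φ ≃g G φ)
    (hvar : ∀ (x : Fin n) (w : ZMod 2), α (Vtx.var x w) = Vtx.var x w) :
    ∀ v : Vtx φ, α v = v := by
  have adj_var (v : Vtx φ) (x : Fin n) (w : ZMod 2) :
      (G φ).Adj (α v) (Vtx.var x w) ↔ (G φ).Adj v (Vtx.var x w) := by
    rw [← hvar x w, α.map_adj_iff, hvar]
  have ne_var {v : Vtx φ} (hv : ∀ x w, v ≠ Vtx.var x w) (x : Fin n) (w : ZMod 2) :
      α v ≠ Vtx.var x w := fun h => hv x w (α.injective (h.trans (hvar x w).symm))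
  have fix_cl (c : {c // c ∈ φ.clauses}) (a b : ZMod 2) :
      α (Vtx.cl c a b) = Vtx.cl c a b :=
    eq_cl_of_adj_var (ne_var (by simp)) fun x w => (adj_var _ x w).2
  have fix_rt_st (i : Fin (n - 1)) : α (Vtx.rt i) = Vtx.rt i ∧ α (Vtx.st i) = Vtx.st i := by
    obtain ⟨k, hk⟩ : ∃ k, α (Vtx.st i) = Vtx.st k :=
      exists_eq_st_of_not_adj_var (ne_var (by simp)) fun x w => by
        simp [adj_var, adj_st_iff]
    have hr : α (Vtx.rt i) = Vtx.rt k := by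
      rw [← adj_st_iff, ← hk, α.map_adj_iff, adj_st_iff]
    have hik : (G φ).Adj (α (Vtx.rt i)) (Vtx.var (high i) 0) :=
      (adj_var _ _ _).2 (adj_rt_var_iff.2 rfl)
    rw [hr, adj_rt_var_iff] at hik
    obtain rfl := high_injective hik
    exact ⟨hr, hk⟩
  intro v
  cases v with
  | cl c a b => exact fix_cl c a b
  | var x w => exact hvar x w
  | rt i => exact (fix_rt_st i).1
  | st i => exact (fix_rt_st i).2
  | lt i =>
    have hi : (G φ).Adj (α (Vtx.lt i)) (Vtx.var (low i) 0) :=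
      (adj_var _ _ _).2 (adj_lt_var_iff.2 rfl)
    cases h : α (Vtx.lt i) with
    | cl c a b => cases α.injective (h.trans (fix_cl c a b).symm)
    | var x w => exact absurd h (ne_var (by simp) x w)
    | rt j => cases α.injective (h.trans (fix_rt_st j).1.symm)
    | st j => cases α.injective (h.trans (fix_rt_st j).2.symm)
    | lt j =>
      rw [h, adj_lt_var_iff] at hi
      rw [low_injective hi]
end

section
/- Suppose n ≥ 2 and every variable occurs in at least one clause of φ. Then for every automorphism α of the graph G_φ, the assignment T : {X_1,…,X_n} → 𝔽₂ defined by T(X) = 1 if α interchanges X^0 and X^1, and T(X) = 0 if α fixes X^0 and X^1, is a satisfying assignment of φ. -/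
open SimpleGraph

namespace HomXor

variable {n : ℕ} {φ : HomXor n}

theorem edge_irrefl (u : Vtx φ) : ¬ Edge φ u u := by
  intro h
  cases h

theorem adj_iff {u v : Vtx φ} : (G φ).Adj u v ↔ Edge φ u v ∨ Edge φ v u := by
  refine ⟨fun h => h.2, fun h => ⟨?_, h⟩⟩
  rintro rfl
  exact edge_irrefl u (or_self_iff.mp h)

theorem adj_st {i : Fin (n - 1)} {v : Vtx φ} : (G φ).Adj (.st i) v ↔ v = .rt i := by
  rw [adj_iff]
  constructor
  · rintro (h | h) <;> cases h
    rfl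
  · rintro rfl
    exact .inr (.rs i)

theorem adj_lt {i : Fin (n - 1)} {v : Vtx φ} :
    (G φ).Adj (.lt i) v ↔ v = .rt i ∨ ∃ a, v = .var (low i) a := by
  rw [adj_iff]
  constructor
  · rintro (h | h) <;> cases h <;> simp
  · rintro (rfl | ⟨a, rfl⟩)
    · exact .inl (.lr i)
    · exact .inl (.lv i a)

theorem adj_rt {i : Fin (n - 1)} {v : Vtx φ} :
    (G φ).Adj (.rt i) v ↔ v = .lt i ∨ v = .st i ∨ ∃ a, v = .var (high i) a := by
  rw [adj_iff]
  constructor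
  · rintro (h | h) <;> cases h <;> simp
  · rintro (rfl | rfl | ⟨a, rfl⟩)
    · exact .inr (.lr i)
    · exact .inl (.rs i)
    · exact .inl (.rv i a)

theorem adj_var_var (x : Fin n) (a : ZMod 2) :
    (G φ).Adj (.var x a) (.var x (a + 1)) := by
  rw [adj_iff]
  fin_cases a
  · exact .inl (.xx x)
  · exact .inr (.xx x)

theorem eq_of_adj_var_var {x y : Fin n} {a b : ZMod 2}
    (h : (G φ).Adj (.var x a) (.var y b)) : x = y := by
  rw [adj_iff] at h
  rcases h with h | h <;> cases h <;> rfl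

theorem adj_cl_var {c : {c // c ∈ φ.clauses}} {a b v : ZMod 2} {x : Fin n} :
    (G φ).Adj (.cl c a b) (.var x v) ↔
      x = c.1.1 ∧ v = 1 + a ∨ x = c.1.2.1 ∧ v = 1 + b ∨ x = c.1.2.2 ∧ v = 1 + a + b := by
  rw [adj_iff]
  constructor
  · rintro (h | h) <;> cases h <;> simp
  · rintro (⟨rfl, rfl⟩ | ⟨rfl, rfl⟩ | ⟨rfl, rfl⟩)
    · exact .inl (.cx c a b)
    · exact .inl (.cy c a b)
    · exact .inl (.cz c a b)

theorem exists_eq_low_or_high (hn : 2 ≤ n) (x : Fin n) :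
    ∃ i : Fin (n - 1), x = low i ∨ x = high i := by
  by_cases hx : x.1 = 0
  · exact ⟨⟨0, by omega⟩, .inl (Fin.ext hx)⟩
  · exact ⟨⟨x.1 - 1, by omega⟩, .inr (Fin.ext (by simp only [high]; omega))⟩

theorem exists_two_neighbors (hn : 2 ≤ n) (v : Vtx φ) (hv : ∀ i, v ≠ .st i) :
    ∃ w w', w ≠ w' ∧ (G φ).Adj v w ∧ (G φ).Adj v w' := by
  cases v with
  | cl c a b =>
    refine ⟨.var c.1.1 (1 + a), .var c.1.2.1 (1 + b), ?_, ?_, ?_⟩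
    · simp [(φ.ordered c.1 c.2).1.ne]
    · simp [adj_cl_var]
    · simp [adj_cl_var]
  | var x a =>
    obtain ⟨i, rfl | rfl⟩ := exists_eq_low_or_high hn x
    · exact ⟨.var _ (a + 1), .lt i, by simp, adj_var_var _ _, (adj_lt.2 (.inr ⟨a, rfl⟩)).symm⟩
    · exact ⟨.var _ (a + 1), .rt i, by simp, adj_var_var _ _,
        (adj_rt.2 (.inr (.inr ⟨a, rfl⟩))).symm⟩
  | lt i => exact ⟨.rt i, .var (low i) 0, by simp, by simp [adj_lt], by simp [adj_lt]⟩
  | rt i => exact ⟨.lt i, .st i, by simp, by simp [adj_rt], by simp [adj_rt]⟩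
  | st i => exact absurd rfl (hv i)

theorem exists_map_st (hn : 2 ≤ n) (α : G φ ≃g G φ) (i : Fin (n - 1)) :
    ∃ j, α (.st i) = .st j := by
  by_contra! h
  obtain ⟨w, w', hne, hw, hw'⟩ := exists_two_neighbors hn _ h
  have key : ∀ u, (G φ).Adj (α (.st i)) u → u = α (.rt i) := fun u hu => by
    rw [← α.apply_symm_apply u, α.map_adj_iff, adj_st] at hu
    rw [← hu, α.apply_symm_apply]
  exact hne ((key w hw).trans (key w' hw').symm)

theorem map_rt {α : G φ ≃g G φ} {i j : Fin (n - 1)} (h : α (.st i) = .st j) :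
    α (.rt i) = .rt j := by
  rw [← adj_st, ← h, α.map_adj_iff, adj_st]

theorem map_var_high {α : G φ ≃g G φ} {i j : Fin (n - 1)} (h : α (.st i) = .st j) (a : ZMod 2) :
    ∃ b, α (.var (high i) a) = .var (high j) b := by
  have hadj : ∀ a, (G φ).Adj (.rt j) (α (.var (high i) a)) := fun a => by
    rw [← map_rt h, α.map_adj_iff]
    exact adj_rt.2 (.inr (.inr ⟨a, rfl⟩))
  rcases adj_rt.1 (hadj a) with hl | hs | hv
  · have hadj' := α.map_adj_iff.2 (adj_var_var (φ := φ) (high i) a)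
    rw [hl, adj_lt] at hadj'
    have hadj'' := adj_rt.1 (hadj (a + 1))
    rcases hadj' with h' | ⟨b, h'⟩ <;> rw [h'] at hadj''
    · simp at hadj''
    · simp [low, high] at hadj''
  · exact absurd (α.injective (hs.trans h.symm)) (by simp)
  · exact hv

theorem map_lt {α : G φ ≃g G φ} {i j : Fin (n - 1)} (h : α (.st i) = .st j) :
    α (.lt i) = .lt j := by
  have hadj : (G φ).Adj (.rt j) (α (.lt i)) := by
    rw [← map_rt h, α.map_adj_iff]
    exact adj_rt.2 (.inl rfl)
  rcases adj_rt.1 hadj with hl | hs | ⟨c, hc⟩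
  · exact hl
  · exact absurd (α.injective (hs.trans h.symm)) (by simp)
  · obtain ⟨a, ha⟩ := map_var_high h 0
    obtain ⟨b, hb⟩ := map_var_high h 1
    have hab : a ≠ b := by
      rintro rfl
      simpa using α.injective (ha.trans hb.symm)
    have hac : a ≠ c := by
      rintro rfl
      simpa using α.injective (ha.trans hc.symm)
    have hbc : b ≠ c := by
      rintro rfl
      simpa using α.injective (hb.trans hc.symm)
    have hfalse : ∀ p q r : ZMod 2, p ≠ q → p ≠ r → q ≠ r → False := by decide
    exact (hfalse a b c hab hac hbc).elim

theorem map_var_low {α : G φ ≃g G φ} {i j : Fin (n - 1)} (h : α (.st i) = .st j) (a : ZMod 2) :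
    ∃ b, α (.var (low i) a) = .var (low j) b := by
  have hadj : (G φ).Adj (.lt j) (α (.var (low i) a)) := by
    rw [← map_lt h, α.map_adj_iff]
    exact adj_lt.2 (.inr ⟨a, rfl⟩)
  rcases adj_lt.1 hadj with hr | hv
  · exact absurd (α.injective (hr.trans (map_rt h).symm)) (by simp)
  · exact hv

theorem map_st (hn : 2 ≤ n) (α : G φ ≃g G φ) (i : Fin (n - 1)) : α (.st i) = .st i := by
  choose σ hσ using exists_map_st hn α
  have hstep : ∀ i i' : Fin (n - 1), i'.1 = i.1 + 1 → (σ i').1 = (σ i).1 + 1 := by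
    intro i i' hi
    obtain ⟨a, ha⟩ := map_var_high (hσ i) 0
    obtain ⟨b, hb⟩ := map_var_low (hσ i') 0
    have : low i' = high i := Fin.ext hi
    rw [this, ha] at hb
    simp only [Vtx.var.injEq, low, high, Fin.mk.injEq] at hb
    exact hb.1.symm
  have hpos : 0 < n - 1 := by omega
  have hshift : ∀ k (hk : k < n - 1), (σ ⟨k, hk⟩).1 = (σ ⟨0, hpos⟩).1 + k := by
    intro k
    induction k with
    | zero => simp
    | succ k ih =>
      intro hk
      have hs := hstep ⟨k, by omega⟩ ⟨k + 1, hk⟩ rfl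
      have := ih (by omega)
      omega
  have hlast := hshift (n - 2) (by omega)
  have hlt := (σ ⟨n - 2, by omega⟩).2
  have hi := hshift i.1 i.2
  rw [hσ, Vtx.st.injEq]
  exact Fin.ext (by simp only [Fin.eta] at hi; omega)

/-- Every automorphism of `G_φ` preserves each pair `{X^0, X^1}`. -/
theorem exists_map_var (hn : 2 ≤ n) (α : G φ ≃g G φ) (x : Fin n) (a : ZMod 2) :
    ∃ b, α (.var x a) = .var x b := by
  obtain ⟨i, rfl | rfl⟩ := exists_eq_low_or_high hn x
  · exact map_var_low (map_st hn α i) a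
  · exact map_var_high (map_st hn α i) a

theorem map_var_one (hn : 2 ≤ n) (α : G φ ≃g G φ) (x : Fin n) :
    α (.var x 1) = .var x (1 + if α (.var x 0) = .var x 1 then 1 else 0) := by
  obtain ⟨a, ha⟩ := exists_map_var hn α x 0
  obtain ⟨b, hb⟩ := exists_map_var hn α x 1
  have hab : a ≠ b := by
    rintro rfl
    simpa using α.injective (ha.trans hb.symm)
  rw [ha, hb]
  simp only [Vtx.var.injEq, true_and]
  clear ha hb
  decide +revert

theorem sum_eq_of_adj_var {v : Vtx φ} {x y z : Fin n} (hxy : x < y) (hyz : y < z)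
    {a b c : ZMod 2} (hx : (G φ).Adj v (.var x a)) (hy : (G φ).Adj v (.var y b))
    (hz : (G φ).Adj v (.var z c)) : a + b + c = 1 := by
  cases v with
  | cl d p q =>
    have hd := φ.ordered d.1 d.2
    have habc : a = 1 + p ∧ b = 1 + q ∧ c = 1 + p + q := by
      rw [adj_cl_var] at hx hy hz
      grind
    obtain ⟨rfl, rfl, rfl⟩ := habc
    clear hx hy hz
    decide +revert
  | var w d => exact absurd ((eq_of_adj_var_var hx).symm.trans (eq_of_adj_var_var hy)) hxy.ne
  | lt i =>
    simp only [adj_lt, reduceCtorEq, Vtx.var.injEq, false_or] at hx hy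
    grind
  | rt i =>
    simp only [adj_rt, reduceCtorEq, Vtx.var.injEq, false_or] at hx hy
    grind
  | st i => simp [adj_st] at hx

end HomXor

open HomXor in
/-- If `n ≥ 2` and every variable occurs in at least one clause of `φ`, then
for every automorphism `α` of `G_φ`, the assignment `T` with `T(X) = 1` if
`α` interchanges `X^0` and `X^1` and `T(X) = 0` if `α` fixes them, is a
satisfying assignment of `φ`.  (By the previous lemma `α` always either fixes
or interchanges the pair, so the `if` below captures exactly this `T`.) -/
theorem assignment_from_automorphism_satisfies {n : ℕ} (φ : HomXor n)
    (hn : 2 ≤ n) (hocc : ∀ x : Fin n, φ.OccursIn x) (α : G φ ≃g G φ) :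
    φ.Satisfies (fun x =>
      if α (Vtx.var x 0) = Vtx.var x 1 then (1 : ZMod 2) else 0) := by
  intro c hc
  obtain ⟨hxy, hyz⟩ := φ.ordered c hc
  have hadj : ∀ x, (G φ).Adj (.cl ⟨c, hc⟩ 0 0) (.var x 1) →
      (G φ).Adj (α (.cl ⟨c, hc⟩ 0 0))
        (.var x (1 + if α (.var x 0) = .var x 1 then 1 else 0)) := fun x h => by
    rw [← map_var_one hn α x]
    exact α.map_adj_iff.2 h
  have hsum := sum_eq_of_adj_var hxy hyz (hadj c.1 (by simp [adj_cl_var]))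
    (hadj c.2.1 (by simp [adj_cl_var])) (hadj c.2.2 (by simp [adj_cl_var]))
  dsimp only
  generalize (if α (.var c.1 0) = .var c.1 1 then (1 : ZMod 2) else 0) = p at hsum ⊢
  generalize (if α (.var c.2.1 0) = .var c.2.1 1 then (1 : ZMod 2) else 0) = q at hsum ⊢
  generalize (if α (.var c.2.2 0) = .var c.2.2 1 then (1 : ZMod 2) else 0) = r at hsum ⊢
  revert p q r
  decide
end
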